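/- There exist absolute constants c > 0 and c₀ > 0 such that the following holds. Let k be an odd integer with k ≥ 3, let n, ℓ be integers with 2(k−1) ≤ ℓ ≤ n, and let {H_u}_{u∈[p]} be a simple (1/4,ℓ)-regular p-bipartite k-uniform hypergraph on [n] with m hyperedges, where m ≥ max{ c^k · (n/ℓ)^{(k−1)/2} · √(pℓ) · (log₂ n)^{2k+0.5} , 16p } and |H_u| = m/p for every u ∈ [p]. Let b_{u,C} ∈ {−1,1} be arbitrary signs and let ψ(y,x) = (1/m) Σ_{u∈[p]} y_u Σ_{C∈H_u} b_{u,C} x_C. If the bipartite hypergraph contains no even cover of length at most c₀·ℓ·log₂ n, then val(ψ) ≤ 1/2. -/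

import Mathlib

open Finset
open scoped Classical

/-- `W` is an even cover of the simple `p`-bipartite hypergraph `{B u}_{u}` on `[n]`:
a nonempty set of (distinct) hyperedges `(u, C)` with `C ∈ B u` such that every
`u ∈ [p]` occurs an even number of times and every vertex `v ∈ [n]` lies in an even
number of the sets `C` (counted with multiplicity). -/
def IsBipartiteEvenCover {n p : ℕ} (B : Fin p → Finset (Finset (Fin n)))
    (W : Finset (Fin p × Finset (Fin n))) : Prop :=
  W.Nonempty ∧ (∀ e ∈ W, e.2 ∈ B e.1) ∧
  (∀ u : Fin p, Even ((W.filter (fun e => e.1 = u)).card)) ∧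
  (∀ v : Fin n, Even ((W.filter (fun e => v ∈ e.2)).card))

/-- The endpoint of the walk that starts at `v` and follows the labels in a list. -/
def walkEnd {V E : Type*} (τ : E → V → V) : V → List E → V
  | v, [] => v
  | v, e :: l => walkEnd τ (τ e v) l

/-- The walks of length `t` from `v`, given by their labels, whose colours are pairwise distinct
and lie in `U`. -/
noncomputable def rainbowWalks {V E κ : Type*} (out : V → Finset E) (τ : E → V → V) (col : E → κ) :
    ℕ → V → Finset κ → Finset (List E)
  | 0, _, _ => {[]}
  | t + 1, v, U => ((out v).filter (fun e => col e ∈ U)).biUnion fun e =>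
      (rainbowWalks out τ col t (τ e v) (U.erase (col e))).image (List.cons e)

section RainbowWalks

variable {V E κ : Type*} {out : V → Finset E} {τ : E → V → V} {col : E → κ}

lemma mem_rainbowWalks_succ {t : ℕ} {v : V} {U : Finset κ} {l : List E} :
    l ∈ rainbowWalks out τ col (t + 1) v U ↔ ∃ e l', l = e :: l' ∧ e ∈ out v ∧ col e ∈ U ∧
      l' ∈ rainbowWalks out τ col t (τ e v) (U.erase (col e)) := by
  simp only [rainbowWalks, mem_biUnion, mem_filter, mem_image]
  constructor
  · rintro ⟨e, ⟨he, hU⟩, l', hl', rfl⟩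
    exact ⟨e, l', rfl, he, hU, hl'⟩
  · rintro ⟨e, l', rfl, he, hU, hl'⟩
    exact ⟨e, ⟨he, hU⟩, l', hl', rfl⟩

lemma rainbowWalks_spec {t : ℕ} :
    ∀ {v : V} {U : Finset κ} {l : List E}, l ∈ rainbowWalks out τ col t v U →
      l.length = t ∧ (∀ e ∈ l, ∃ w, e ∈ out w) ∧ (l.map col).Nodup ∧ ∀ e ∈ l, col e ∈ U := by
  induction t with
  | zero =>
    intro v U l hl
    obtain rfl : l = [] := by simpa [rainbowWalks] using hl
    simp
  | succ t ih =>
    intro v U l hl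
    obtain ⟨e, l, rfl, he, hU, hl⟩ := mem_rainbowWalks_succ.1 hl
    obtain ⟨h1, h2, h3, h4⟩ := ih hl
    refine ⟨by simp [h1], ?_, ?_, ?_⟩
    · simpa using ⟨⟨v, he⟩, h2⟩
    · simp only [List.map_cons, List.nodup_cons, h3, and_true, List.mem_map, not_exists, not_and]
      exact fun a ha => (mem_erase.1 (h4 a ha)).1
    · simpa [hU] using fun a ha => (mem_erase.1 (h4 a ha)).2

lemma walkEnd_mem_of_mem_rainbowWalks {A : Finset V} (hA : ∀ v ∈ A, ∀ e ∈ out v, τ e v ∈ A)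
    {t : ℕ} : ∀ {v : V} {U : Finset κ} {l : List E}, v ∈ A → l ∈ rainbowWalks out τ col t v U →
      walkEnd τ v l ∈ A := by
  induction t with
  | zero =>
    intro v U l hv hl
    obtain rfl : l = [] := by simpa [rainbowWalks] using hl
    simpa [walkEnd] using hv
  | succ t ih =>
    intro v U l hv hl
    obtain ⟨e, l, rfl, he, hU, hl⟩ := mem_rainbowWalks_succ.1 hl
    exact ih (v := τ e v) (hA v hv e he) hl

lemma rainbowWalks_restrict {t : ℕ} :
    ∀ {v : V} {U U' : Finset κ} {l : List E}, l ∈ rainbowWalks out τ col t v U →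
      (∀ e ∈ l, col e ∈ U') → l ∈ rainbowWalks out τ col t v U' := by
  induction t with
  | zero => intro v U U' l hl _; simpa [rainbowWalks] using hl
  | succ t ih =>
    intro v U U' l hl h
    obtain ⟨e, l, rfl, he, hU, hl⟩ := mem_rainbowWalks_succ.1 hl
    refine mem_rainbowWalks_succ.2 ⟨e, l, rfl, he, h e (by simp), ih hl fun a ha => ?_⟩
    have h4 := (rainbowWalks_spec hl).2.2.2 a ha
    exact mem_erase.2 ⟨(mem_erase.1 h4).1, h a (by simp [ha])⟩

lemma card_rainbowWalks_succ {t : ℕ} {v : V} {U : Finset κ} :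
    (rainbowWalks out τ col (t + 1) v U).card =
      ∑ e ∈ (out v).filter (fun e => col e ∈ U),
        (rainbowWalks out τ col t (τ e v) (U.erase (col e))).card := by
  rw [rainbowWalks, card_biUnion]
  · exact sum_congr rfl fun e _ => card_image_of_injective _ List.cons_injective
  · intro e _ e' _ hee
    rw [Function.onFun, disjoint_left]
    intro l hl hl'
    obtain ⟨a, -, rfl⟩ := mem_image.1 hl
    obtain ⟨a', -, h⟩ := mem_image.1 hl'
    exact hee (List.cons.inj h).1.symm

lemma card_filter_col_mem_le {s : Finset E} {Δ : ℕ}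
    (hΔ : ∀ c, (s.filter (fun e => col e = c)).card ≤ Δ) (U : Finset κ) :
    (s.filter (fun e => col e ∈ U)).card ≤ Δ * U.card := by
  refine card_le_mul_card_image_of_maps_to (f := col) (fun e he => (mem_filter.1 he).2) Δ
    fun c _ => (card_le_card ?_).trans (hΔ c)
  exact filter_subset_filter _ (filter_subset _ _)

lemma card_rainbowWalks_le {Δ : ℕ}
    (hΔ : ∀ v c, ((out v).filter (fun e => col e = c)).card ≤ Δ) {K t : ℕ} :
    ∀ {v : V} {U : Finset κ}, U.card ≤ K →
      (rainbowWalks out τ col t v U).card ≤ (Δ * K) ^ t := by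
  induction t with
  | zero => intro v U _; simp [rainbowWalks]
  | succ t ih =>
    intro v U hU
    rw [card_rainbowWalks_succ, pow_succ, mul_comm]
    refine (sum_le_card_nsmul _ _ _ fun e _ =>
      ih ((card_le_card (erase_subset _ _)).trans hU)).trans ?_
    rw [smul_eq_mul]
    gcongr
    exact (card_filter_col_mem_le (hΔ v) U).trans (Nat.mul_le_mul_left _ hU)

lemma pow_le_card_rainbowWalks [Fintype κ] {A : Finset V}
    (hA : ∀ v ∈ A, ∀ e ∈ out v, τ e v ∈ A) {d r Δ : ℕ} (hd : ∀ v ∈ A, d ≤ (out v).card)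
    (hΔ : ∀ v c, ((out v).filter (fun e => col e = c)).card ≤ Δ) {t : ℕ} :
    ∀ {v : V} {U : Finset κ}, v ∈ A → r + Δ * (Uᶜ.card + t) ≤ d →
      r ^ t ≤ (rainbowWalks out τ col t v U).card := by
  induction t with
  | zero => intro v U _ _; simp [rainbowWalks]
  | succ t ih =>
    intro v U hv hU
    have hsplit := card_filter_add_card_filter_not (s := out v) (fun e => col e ∈ U)
    have hc := card_filter_col_mem_le (hΔ v) Uᶜ
    simp only [mem_compl] at hc
    have hdv := hd v hv
    have hr : r ≤ ((out v).filter (fun e => col e ∈ U)).card := by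
      have : Δ * (Uᶜ.card + (t + 1)) = Δ * Uᶜ.card + Δ * (t + 1) := by ring
      omega
    rw [card_rainbowWalks_succ, pow_succ, mul_comm]
    refine (Nat.mul_le_mul_right _ hr).trans ?_
    rw [← smul_eq_mul]
    refine card_nsmul_le_sum _ _ _ fun e he => ?_
    obtain ⟨he, heU⟩ := mem_filter.1 he
    refine ih (hA v hv e he) ?_
    rw [compl_erase, card_insert_of_notMem (by simpa using heU)]
    rwa [add_right_comm _ 1 t, add_assoc]

/-- In a labelled graph with large minimum degree in which every colour has degree at most `Δ`,
two rainbow walks of logarithmic length share their endpoints but not their colours. -/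
lemma exists_rainbowWalks_of_min_degree [Fintype κ] {A : Finset V} (hne : A.Nonempty)
    (hA : ∀ v ∈ A, ∀ e ∈ out v, τ e v ∈ A) {Δ t : ℕ} (hΔ0 : 0 < Δ) (ht : 0 < t)
    (hd : ∀ v ∈ A, 3 * (Δ * t) ≤ (out v).card)
    (hΔ : ∀ v c, ((out v).filter (fun e => col e = c)).card ≤ Δ) (hcard : A.card < 2 ^ t) :
    ∃ v ∈ A, ∃ l l', l ∈ rainbowWalks out τ col t v univ ∧ l' ∈ rainbowWalks out τ col t v univ ∧
      walkEnd τ v l = walkEnd τ v l' ∧ ∃ e ∈ l, ∀ e' ∈ l', col e' ≠ col e := by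
  by_contra! H
  obtain ⟨v, hv⟩ := hne
  have hlow : (2 * (Δ * t)) ^ t ≤ (rainbowWalks out τ col t v univ).card :=
    pow_le_card_rainbowWalks hA hd hΔ hv (by simp; omega)
  have hup : (rainbowWalks out τ col t v univ).card ≤ (Δ * t) ^ t * A.card := by
    refine card_le_mul_card_image_of_maps_to (f := walkEnd τ v)
      (fun l hl => walkEnd_mem_of_mem_rainbowWalks hA hv hl) _ fun w _ => ?_
    rcases ((rainbowWalks out τ col t v univ).filter
      (fun l => walkEnd τ v l = w)).eq_empty_or_nonempty with h0 | ⟨l₀, hl₀⟩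
    · simp [h0]
    obtain ⟨hl₀, hw⟩ := mem_filter.1 hl₀
    have hsub : (rainbowWalks out τ col t v univ).filter (fun l => walkEnd τ v l = w) ⊆
        rainbowWalks out τ col t v (l₀.map col).toFinset := by
      intro l hl
      obtain ⟨hl, hlw⟩ := mem_filter.1 hl
      refine rainbowWalks_restrict hl fun e he => ?_
      obtain ⟨e', he', h⟩ := H v hv l l₀ hl hl₀ (hlw.trans hw.symm) e he
      simpa using ⟨e', he', h⟩
    refine (card_le_card hsub).trans (card_rainbowWalks_le hΔ ?_)
    refine (List.toFinset_card_le _).trans ?_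
    simp [(rainbowWalks_spec hl₀).1]
  have hpos : 0 < (Δ * t) ^ t := by positivity
  have : 2 ^ t * (Δ * t) ^ t ≤ A.card * (Δ * t) ^ t := by
    rw [← mul_pow, mul_comm A.card]; exact hlow.trans hup
  exact absurd (Nat.le_of_mul_le_mul_right this hpos) (by omega)

/-- A nonempty graph of average degree at least `2 * d` has a nonempty subgraph of minimum degree
at least `d`. -/
lemma exists_subset_min_degree
    (hsymm : ∀ v, ∀ e ∈ out v, e ∈ out (τ e v) ∧ τ e (τ e v) = v) {d : ℕ} {A : Finset V}
    (hne : A.Nonempty) (hA : ∀ v ∈ A, ∀ e ∈ out v, τ e v ∈ A)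
    (havg : 2 * d * A.card ≤ ∑ v ∈ A, (out v).card) :
    ∃ A' ⊆ A, A'.Nonempty ∧ ∀ v ∈ A', d ≤ ((out v).filter (fun e => τ e v ∈ A')).card := by
  let P : Finset V → Prop := fun S => S.Nonempty ∧
    2 * d * S.card ≤ ∑ v ∈ S, ((out v).filter (fun e => τ e v ∈ S)).card
  have hPA : P A := by
    refine ⟨hne, havg.trans (sum_le_sum fun v hv => ?_)⟩
    rw [filter_true_of_mem (hA v hv)]
  obtain ⟨S, hS, hmin⟩ := exists_min_image (A.powerset.filter P) card
    ⟨A, by simpa using hPA⟩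
  obtain ⟨hSA, hSne, hSe⟩ := mem_filter.1 hS
  refine ⟨S, mem_powerset.1 hSA, hSne, ?_⟩
  by_contra! H
  obtain ⟨v, hv, hlt⟩ := H
  have hin : ∑ w ∈ S.erase v, ((out w).filter (fun e => τ e w = v)).card ≤
      ((out v).filter (fun e => τ e v ∈ S)).card := by
    rw [← card_sigma]
    refine card_le_card_of_injOn (fun x => x.2) ?_ ?_
    · rintro ⟨w, e⟩ h
      simp only [coe_sigma, Set.mem_sigma_iff, mem_coe, mem_erase, mem_filter] at h
      obtain ⟨⟨-, hw⟩, he, rfl⟩ := h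
      have := hsymm w e he
      simpa [this.2] using ⟨this.1, hw⟩
    · rintro ⟨w, e⟩ h ⟨w', e'⟩ h' hee
      simp only [coe_sigma, Set.mem_sigma_iff, mem_coe, mem_erase, mem_filter] at h h'
      obtain rfl : e = e' := hee
      have h1 := (hsymm w e h.2.1).2
      have h2 := (hsymm w' e h'.2.1).2
      rw [h.2.2] at h1
      rw [h'.2.2] at h2
      rw [← h1, ← h2]
  have hsplit : ∀ w ∈ S.erase v, ((out w).filter (fun e => τ e w ∈ S)).card ≤
      ((out w).filter (fun e => τ e w ∈ S.erase v)).card +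
        ((out w).filter (fun e => τ e w = v)).card := by
    intro w _
    refine (card_le_card fun e he => ?_).trans (card_union_le _ _)
    simp only [mem_filter, mem_union, mem_erase] at he ⊢
    tauto
  have hsum := sum_le_sum hsplit
  rw [sum_add_distrib] at hsum
  rw [← add_sum_erase _ _ hv] at hSe
  have hc := card_erase_add_one hv
  have hlarge : 2 * d * (S.erase v).card ≤
      ∑ w ∈ S.erase v, ((out w).filter (fun e => τ e w ∈ S.erase v)).card := by
    rw [← hc, mul_add] at hSe
    omega
  rcases (S.erase v).eq_empty_or_nonempty with h0 | hne'
  · rw [h0] at hc hSe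
    rw [← hc] at hSe
    simp at hSe
    omega
  · have := hmin (S.erase v) (mem_filter.2 ⟨mem_powerset.2
      ((erase_subset _ _).trans (mem_powerset.1 hSA)), hne', hlarge⟩)
    omega

end RainbowWalks

section SplittingSets

variable {n : ℕ}

/-- The `L`-element sets that contain exactly `h` elements of `C`. -/
noncomputable def splittingSets (L h : ℕ) (C : Finset (Fin n)) : Finset (Finset (Fin n)) :=
  (powersetCard L univ).filter (fun S => (S ∩ C).card = h)

/-- The number of members of `H` having exactly `h` elements in `S`. -/
noncomputable def splitDegree (h : ℕ) (H : Finset (Finset (Fin n))) (S : Finset (Fin n)) : ℕ :=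
  (H.filter (fun D => (S ∩ D).card = h)).card

lemma mem_splittingSets {L h : ℕ} {C S : Finset (Fin n)} :
    S ∈ splittingSets L h C ↔ S.card = L ∧ (S ∩ C).card = h := by
  simp [splittingSets, mem_powersetCard]

lemma card_filter_subset_disjoint {L : ℕ} {P Z : Finset (Fin n)} (hPZ : Disjoint P Z)
    (hP : P.card ≤ L) :
    ((powersetCard L univ).filter (fun S => P ⊆ S ∧ Disjoint S Z)).card =
      (n - (P.card + Z.card)).choose (L - P.card) := by
  have hcard : (P ∪ Z)ᶜ.card = n - (P.card + Z.card) := by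
    rw [card_compl, Fintype.card_fin, card_union_of_disjoint hPZ]
  rw [← hcard, ← card_powersetCard]
  refine card_nbij' (· \ P) (· ∪ P) ?_ ?_ ?_ ?_
  · intro S hS
    simp only [coe_filter, mem_powersetCard, subset_univ, true_and, Set.mem_ofPred_eq] at hS
    obtain ⟨hS, hPS, hSZ⟩ := hS
    refine mem_coe.2 (mem_powersetCard.2 ⟨fun x hx => ?_, by rw [card_sdiff_of_subset hPS, hS]⟩)
    obtain ⟨hx, hxP⟩ := mem_sdiff.1 hx
    simpa [hxP] using disjoint_left.1 hSZ hx
  · intro S hS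
    obtain ⟨hS, hSc⟩ := mem_powersetCard.1 (mem_coe.1 hS)
    have hSP : Disjoint S P := disjoint_left.2 fun x hx hxP => by
      simpa [hxP] using hS hx
    refine mem_coe.2 (mem_filter.2 ⟨mem_powersetCard.2 ⟨subset_univ _, ?_⟩,
      subset_union_right, disjoint_union_left.2 ⟨?_, hPZ⟩⟩)
    · rw [card_union_of_disjoint hSP, hSc]; omega
    · exact disjoint_left.2 fun x hx hxZ => by simpa [hxZ] using hS hx
  · intro S hS
    exact sdiff_union_of_subset (mem_filter.1 (mem_coe.1 hS)).2.1
  · intro S hS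
    obtain ⟨hS, -⟩ := mem_powersetCard.1 (mem_coe.1 hS)
    refine union_sdiff_cancel_right (disjoint_left.2 fun x hx hxP => by simpa [hxP] using hS hx)

lemma inter_eq_iff_subset_disjoint {S C P : Finset (Fin n)} (hP : P ⊆ C) :
    S ∩ C = P ↔ P ⊆ S ∧ Disjoint S (C \ P) := by
  constructor
  · rintro rfl
    refine ⟨inter_subset_left, disjoint_left.2 fun x hx hx' => ?_⟩
    simp only [mem_sdiff, mem_inter] at hx'
    tauto
  · rintro ⟨hPS, hd⟩
    ext x
    rw [mem_inter]
    refine ⟨fun ⟨hx, hxC⟩ => ?_, fun hx => ⟨hPS hx, hP hx⟩⟩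
    by_contra hxP
    exact disjoint_left.1 hd hx (mem_sdiff.2 ⟨hxC, hxP⟩)

lemma card_filter_inter_eq {L h : ℕ} {C P : Finset (Fin n)} (hC : C.card = 2 * h) (hP : P ⊆ C)
    (hPc : P.card = h) (hL : h ≤ L) :
    ((powersetCard L univ).filter (fun S => S ∩ C = P)).card = (n - 2 * h).choose (L - h) := by
  simp_rw [inter_eq_iff_subset_disjoint hP]
  rw [card_filter_subset_disjoint disjoint_sdiff (hPc.trans_le hL), card_sdiff_of_subset hP, hC,
    hPc]
  congr 1
  omega

lemma card_splittingSets {L h : ℕ} {C : Finset (Fin n)} (hC : C.card = 2 * h) (hL : h ≤ L) :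
    (splittingSets L h C).card = (2 * h).choose h * (n - 2 * h).choose (L - h) := by
  rw [card_eq_sum_card_fiberwise (f := fun S => S ∩ C) (t := powersetCard h C)]
  · rw [← hC, ← card_powersetCard, ← smul_eq_mul, ← sum_const]
    refine sum_congr rfl fun P hP => ?_
    obtain ⟨hP, hPc⟩ := mem_powersetCard.1 hP
    rw [hC, ← card_filter_inter_eq hC hP hPc hL]
    congr 1
    ext S
    simp only [splittingSets, mem_filter]
    constructor
    · tauto
    · rintro ⟨h1, rfl⟩
      exact ⟨⟨h1, hPc⟩, rfl⟩
  · intro S hS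
    exact mem_coe.2 (mem_powersetCard.2 ⟨inter_subset_right, (mem_splittingSets.1 hS).2⟩)

lemma choose_sub_mul_pow_le {N K L m a : ℕ} (hKN : K ≤ N) (hLm : L ≤ m) (hKm : K * m ≤ L * N) :
    a ≤ K → (N - a).choose (K - a) * m ^ a ≤ N.choose K * L ^ a := by
  induction a with
  | zero => simp
  | succ a ih =>
    intro ha
    specialize ih (by omega)
    obtain ⟨x, hx⟩ : ∃ x, N - a = x + 1 := ⟨N - a - 1, by omega⟩
    obtain ⟨y, hy⟩ : ∃ y, K - a = y + 1 := ⟨K - a - 1, by omega⟩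
    have hx' : N - (a + 1) = x := by omega
    have hy' : K - (a + 1) = y := by omega
    rw [hx, hy] at ih
    rw [hx', hy']
    have hid := Nat.add_one_mul_choose_eq x y
    have hxy : (y + 1) * m ≤ L * (x + 1) := by
      have h1 : N = x + 1 + a := by omega
      have h2 : K = y + 1 + a := by omega
      rw [h1, h2] at hKm
      have h3 : a * L ≤ a * m := Nat.mul_le_mul_left _ hLm
      linarith
    refine Nat.le_of_mul_le_mul_left ?_ (Nat.succ_pos x)
    calc (x + 1) * (x.choose y * m ^ (a + 1))
        = (x + 1).choose (y + 1) * m ^ a * ((y + 1) * m) := by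
          rw [← mul_assoc, hid]; ring
      _ ≤ N.choose K * L ^ a * (L * (x + 1)) := by gcongr
      _ = (x + 1) * (N.choose K * L ^ (a + 1)) := by ring

lemma choose_mul_pow_le {m L h : ℕ} (hL : 2 * h ≤ L) (hm : 2 * L ≤ m) :
    ∀ i ≤ h, m.choose L * L ^ i ≤ (8 * m) ^ i * (m - 2 * i).choose (L - i) := by
  intro i
  induction i with
  | zero => simp
  | succ i ih =>
    intro hi
    specialize ih (by omega)
    obtain ⟨x, hx⟩ : ∃ x, m - 2 * i = x + 2 := ⟨m - 2 * i - 2, by omega⟩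
    obtain ⟨y, hy⟩ : ∃ y, L - i = y + 1 := ⟨L - i - 1, by omega⟩
    have hx' : m - 2 * (i + 1) = x := by omega
    have hy' : L - (i + 1) = y := by omega
    rw [hx, hy] at ih
    rw [hx', hy']
    have hid := Nat.add_one_mul_choose_eq (x + 1) y
    have hid' := Nat.choose_mul_succ_eq x y
    have hstep : (x + 2).choose (y + 1) * L ≤ 8 * m * x.choose y := by
      have hpos : 0 < (x + 2) * (x + 1) * 1 := by positivity
      have h1 : (x + 2) * (x + 1) * x.choose y
          = (x + 2).choose (y + 1) * ((y + 1) * (x + 1 - y)) := by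
        calc (x + 2) * (x + 1) * x.choose y = (x + 2) * (x.choose y * (x + 1)) := by ring
          _ = (x + 1 + 1) * (x + 1).choose y * (x + 1 - y) := by rw [hid']; ring
          _ = _ := by rw [hid]; ring
      have h2 : (x + 2) * (x + 1) * L ≤ 8 * m * ((y + 1) * (x + 1 - y)) := by
        have e1 : L ≤ 2 * (y + 1) := by omega
        have e2 : m ≤ 4 * (x + 1 - y) := by omega
        calc (x + 2) * (x + 1) * L ≤ m * m * (2 * (y + 1)) := by
              gcongr <;> omega
          _ ≤ m * (4 * (x + 1 - y)) * (2 * (y + 1)) := by gcongr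
          _ = _ := by ring
      have hpos' : 0 < (x + 2) * (x + 1) := by positivity
      refine Nat.le_of_mul_le_mul_left ?_ hpos'
      calc (x + 2) * (x + 1) * ((x + 2).choose (y + 1) * L)
          = (x + 2).choose (y + 1) * ((x + 2) * (x + 1) * L) := by ring
        _ ≤ (x + 2).choose (y + 1) * (8 * m * ((y + 1) * (x + 1 - y))) := by gcongr
        _ = (x + 2) * (x + 1) * (8 * m * x.choose y) := by
          rw [show (x + 2) * (x + 1) * (8 * m * x.choose y)
            = 8 * m * ((x + 2) * (x + 1) * x.choose y) by ring, h1]; ring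
    calc m.choose L * L ^ (i + 1) = m.choose L * L ^ i * L := by ring
      _ ≤ (8 * m) ^ i * (x + 2).choose (y + 1) * L := by gcongr
      _ = (8 * m) ^ i * ((x + 2).choose (y + 1) * L) := by ring
      _ ≤ (8 * m) ^ i * (8 * m * x.choose y) := by gcongr
      _ = _ := by ring

lemma card_filter_inter_eq_subset_le {L h : ℕ} {C P Q : Finset (Fin n)} (hC : C.card = 2 * h)
    (hP : P ⊆ C) (hPc : P.card = h) (hL : h ≤ L) (hLn : 2 * L ≤ n) :
    ((powersetCard L univ).filter (fun S => S ∩ C = P ∧ Q ⊆ S)).card * n ^ (Q \ C).card ≤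
      (n - 2 * h).choose (L - h) * L ^ (Q \ C).card := by
  set a := (Q \ C).card
  have hsub : ∀ S, S ∩ C = P ∧ Q ⊆ S → P ∪ Q \ C ⊆ S ∧ Disjoint S (C \ P) := by
    rintro S ⟨hS, hQ⟩
    obtain ⟨h1, h2⟩ := (inter_eq_iff_subset_disjoint hP).1 hS
    exact ⟨union_subset h1 (sdiff_subset.trans hQ), h2⟩
  have hdisj : Disjoint P (Q \ C) := disjoint_sdiff.mono_left hP
  have hcard : (P ∪ Q \ C).card = h + a := by rw [card_union_of_disjoint hdisj, hPc]
  by_cases haL : h + a ≤ L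
  · have hd : Disjoint (P ∪ Q \ C) (C \ P) :=
      disjoint_union_left.2 ⟨disjoint_sdiff, disjoint_sdiff_self_left.mono_right sdiff_subset⟩
    have h1 := card_filter_subset_disjoint hd (hcard.trans_le haL)
    rw [hcard, card_sdiff_of_subset hP, hC, hPc] at h1
    have h2 : ((powersetCard L univ).filter (fun S => S ∩ C = P ∧ Q ⊆ S)).card ≤ _ :=
      (card_le_card (monotone_filter_right _ fun S _ => hsub S)).trans h1.le
    have h3 : (n - 2 * h - a).choose (L - h - a) * n ^ a ≤
        (n - 2 * h).choose (L - h) * L ^ a := by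
      refine choose_sub_mul_pow_le (by omega) (by omega) ?_ (by omega)
      obtain ⟨K, rfl⟩ := Nat.exists_eq_add_of_le hL
      obtain ⟨N, rfl⟩ := Nat.exists_eq_add_of_le (show 2 * h ≤ n by omega)
      simp only [add_tsub_cancel_left]
      nlinarith
    refine (Nat.mul_le_mul_right _ h2).trans (le_of_eq_of_le ?_ h3)
    congr 2 <;> omega
  · rw [filter_eq_empty_iff.2]
    · simp
    · intro S hS hS'
      have := card_le_card (hsub S hS').1
      rw [(mem_powersetCard.1 hS).2] at this
      omega

lemma card_splittingSets_inter_le {L ℓ h : ℕ} {C D : Finset (Fin n)} (hC : C.card = 2 * h)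
    (hD : D.card = 2 * h) (hL : h ≤ L) (hLn : 2 * L ≤ n) (hLℓ : L ≤ ℓ) (hℓ : ℓ ≤ n) (hn : 0 < n) :
    (((splittingSets L h C).filter (fun S => (S ∩ D).card = h)).card : ℝ) ≤
      4 ^ h * (splittingSets L h C).card * ((ℓ : ℝ) / n) ^ (h - (D ∩ C).card) := by
  have hsub : (splittingSets L h C).filter (fun S => (S ∩ D).card = h) ⊆
      (powersetCard h C ×ˢ powersetCard h D).biUnion
        fun x => (powersetCard L univ).filter (fun S => S ∩ C = x.1 ∧ x.2 ⊆ S) := by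
    intro S hS
    obtain ⟨hS, hSD⟩ := mem_filter.1 hS
    obtain ⟨hSL, hSC⟩ := mem_splittingSets.1 hS
    refine mem_biUnion.2 ⟨(S ∩ C, S ∩ D), mem_product.2 ⟨mem_powersetCard.2
      ⟨inter_subset_right, hSC⟩, mem_powersetCard.2 ⟨inter_subset_right, hSD⟩⟩, ?_⟩
    exact mem_filter.2 ⟨mem_powersetCard.2 ⟨subset_univ _, hSL⟩, rfl, inter_subset_left⟩
  have hcard := (card_le_card hsub).trans card_biUnion_le
  have hn' : (0 : ℝ) < n := by exact_mod_cast hn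
  have hterm : ∀ x ∈ powersetCard h C ×ˢ powersetCard h D,
      (((powersetCard L univ).filter (fun S => S ∩ C = x.1 ∧ x.2 ⊆ S)).card : ℝ) ≤
        (n - 2 * h).choose (L - h) * ((ℓ : ℝ) / n) ^ (h - (D ∩ C).card) := by
    rintro ⟨P, Q⟩ hx
    obtain ⟨hP, hQ⟩ := mem_product.1 hx
    obtain ⟨hP, hPc⟩ := mem_powersetCard.1 hP
    obtain ⟨hQ, hQc⟩ := mem_powersetCard.1 hQ
    have h1 := card_filter_inter_eq_subset_le (Q := Q) hC hP hPc hL hLn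
    have h1' : (((powersetCard L univ).filter (fun S => S ∩ C = P ∧ Q ⊆ S)).card : ℝ) *
        (n : ℝ) ^ (Q \ C).card ≤ (n - 2 * h).choose (L - h) * (L : ℝ) ^ (Q \ C).card := by
      exact_mod_cast h1
    have ha : h - (D ∩ C).card ≤ (Q \ C).card := by
      have h2 : (Q \ C).card + (Q ∩ C).card = Q.card := card_sdiff_add_card_inter Q C
      have h3 : (Q ∩ C).card ≤ (D ∩ C).card := card_le_card (inter_subset_inter_right hQ)
      simp only at hQc
      omega
    calc (((powersetCard L univ).filter (fun S => S ∩ C = P ∧ Q ⊆ S)).card : ℝ)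
        ≤ (n - 2 * h).choose (L - h) * ((L : ℝ) / n) ^ (Q \ C).card := by
          rw [div_pow, ← mul_div_assoc, le_div_iff₀ (by positivity)]
          exact h1'
      _ ≤ (n - 2 * h).choose (L - h) * ((ℓ : ℝ) / n) ^ (Q \ C).card := by gcongr
      _ ≤ _ := by
          refine mul_le_mul_of_nonneg_left (pow_le_pow_of_le_one (by positivity) ?_ ha)
            (by positivity)
          rw [div_le_one hn']
          exact_mod_cast hℓ
  have hchoose : ((2 * h).choose h : ℝ) ≤ 4 ^ h := by
    have := Nat.choose_le_two_pow (2 * h) h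
    rw [pow_mul] at this
    exact_mod_cast this
  calc (((splittingSets L h C).filter (fun S => (S ∩ D).card = h)).card : ℝ)
      ≤ ∑ x ∈ powersetCard h C ×ˢ powersetCard h D,
          (((powersetCard L univ).filter (fun S => S ∩ C = x.1 ∧ x.2 ⊆ S)).card : ℝ) := by
        exact_mod_cast hcard
    _ ≤ _ := sum_le_card_nsmul _ _ _ hterm
    _ = (2 * h).choose h * ((2 * h).choose h * (n - 2 * h).choose (L - h)) *
          ((ℓ : ℝ) / n) ^ (h - (D ∩ C).card) := by
        rw [nsmul_eq_mul, card_product, card_powersetCard, card_powersetCard, hC, hD]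
        push_cast
        ring
    _ ≤ 4 ^ h * ((2 * h).choose h * (n - 2 * h).choose (L - h)) *
          ((ℓ : ℝ) / n) ^ (h - (D ∩ C).card) := by gcongr
    _ = _ := by rw [card_splittingSets hC hL]; push_cast; ring

/-- The regularity condition bounds a weighted count of the intersections with a fixed set. -/
lemma sum_pow_card_inter_le {ℓ h : ℕ} {H : Finset (Finset (Fin n))} {C : Finset (Fin n)}
    (hC : C.card = 2 * h) (hℓ0 : 0 < ℓ) (hℓ : ℓ ≤ n)
    (hreg : ∀ Q : Finset (Fin n), Q.card ≤ 2 * h → ((H.filter (fun D => Q ⊆ D)).card : ℝ) ≤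
      16 * max (((n : ℝ) / ℓ) ^ ((h : ℝ) - 1 / 2 - Q.card)) 1) :
    ∑ D ∈ H, ((ℓ : ℝ) / n) ^ (h - (D ∩ C).card) ≤ 4 ^ h * 16 := by
  have hℓ' : (0 : ℝ) < ℓ := by exact_mod_cast hℓ0
  have hn' : (0 : ℝ) < n := by exact_mod_cast hℓ0.trans_le hℓ
  have hle : (ℓ : ℝ) ≤ n := by exact_mod_cast hℓ
  have hθ : 1 ≤ (n : ℝ) / ℓ := by rwa [le_div_iff₀ hℓ', one_mul]
  rw [← sum_fiberwise_of_maps_to (g := fun D => D ∩ C) (t := C.powerset)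
    fun D _ => mem_powerset.2 inter_subset_right]
  have hQ : ∀ Q ∈ C.powerset, ∑ D ∈ H.filter (fun D => D ∩ C = Q),
      ((ℓ : ℝ) / n) ^ (h - (D ∩ C).card) ≤ 16 := by
    intro Q hQ
    have hQc : Q.card ≤ 2 * h := hC ▸ card_le_card (mem_powerset.1 hQ)
    have hθ' : (ℓ : ℝ) / n ≤ 1 := by rwa [div_le_one hn']
    have hθ0 : (0 : ℝ) ≤ (ℓ : ℝ) / n := by positivity
    calc ∑ D ∈ H.filter (fun D => D ∩ C = Q), ((ℓ : ℝ) / n) ^ (h - (D ∩ C).card)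
        = (H.filter (fun D => D ∩ C = Q)).card * ((ℓ : ℝ) / n) ^ (h - Q.card) := by
          rw [← nsmul_eq_mul, ← sum_const]
          exact sum_congr rfl fun D hD => by rw [(mem_filter.1 hD).2]
      _ ≤ (H.filter (fun D => Q ⊆ D)).card * ((ℓ : ℝ) / n) ^ (h - Q.card) := by
          gcongr with D hD
          rintro rfl
          exact inter_subset_left
      _ ≤ 16 * max (((n : ℝ) / ℓ) ^ ((h : ℝ) - 1 / 2 - Q.card)) 1 *
            ((ℓ : ℝ) / n) ^ (h - Q.card) := by
          gcongr
          exact hreg Q hQc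
      _ ≤ 16 * (((n : ℝ) / ℓ) ^ (h - Q.card)) * ((ℓ : ℝ) / n) ^ (h - Q.card) := by
          gcongr
          refine max_le ?_ (one_le_pow₀ hθ)
          rw [← Real.rpow_natCast]
          refine Real.rpow_le_rpow_of_exponent_le hθ ?_
          have : (h : ℝ) ≤ (h - Q.card : ℕ) + Q.card := by
            exact_mod_cast le_tsub_add
          linarith
      _ = 16 := by
          rw [mul_assoc, ← mul_pow]
          rw [div_mul_div_cancel₀ hℓ'.ne', div_self hn'.ne', one_pow, mul_one]
  refine (sum_le_card_nsmul _ _ _ hQ).trans_eq ?_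
  rw [card_powerset, hC, pow_mul, nsmul_eq_mul]
  norm_num

lemma sum_splitDegree_le {L ℓ h : ℕ} {H : Finset (Finset (Fin n))} {C : Finset (Fin n)}
    (hH : ∀ D ∈ H, D.card = 2 * h) (hC : C.card = 2 * h) (hL : h ≤ L) (hLn : 2 * L ≤ n)
    (hLℓ : L ≤ ℓ) (hℓ0 : 0 < ℓ) (hℓ : ℓ ≤ n)
    (hreg : ∀ Q : Finset (Fin n), Q.card ≤ 2 * h → ((H.filter (fun D => Q ⊆ D)).card : ℝ) ≤
      16 * max (((n : ℝ) / ℓ) ^ ((h : ℝ) - 1 / 2 - Q.card)) 1) :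
    ∑ S ∈ splittingSets L h C, splitDegree h H S ≤ 16 ^ (h + 1) * (splittingSets L h C).card := by
  have hswap : ∑ S ∈ splittingSets L h C, splitDegree h H S =
      ∑ D ∈ H, ((splittingSets L h C).filter (fun S => (S ∩ D).card = h)).card :=
    sum_card_bipartiteAbove_eq_sum_card_bipartiteBelow 
      (fun S D : Finset (Fin n) => (S ∩ D).card = h)
  rw [hswap]
  have : (∑ D ∈ H, ((splittingSets L h C).filter (fun S => (S ∩ D).card = h)).card : ℝ) ≤
      16 ^ (h + 1) * (splittingSets L h C).card := by
    calc _ ≤ ∑ D ∈ H, 4 ^ h * ((splittingSets L h C).card : ℝ) *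
          ((ℓ : ℝ) / n) ^ (h - (D ∩ C).card) := sum_le_sum fun D hD =>
            card_splittingSets_inter_le hC (hH D hD) hL hLn hLℓ hℓ (hℓ0.trans_le hℓ)
      _ = 4 ^ h * ((splittingSets L h C).card : ℝ) *
          ∑ D ∈ H, ((ℓ : ℝ) / n) ^ (h - (D ∩ C).card) := by rw [mul_sum]
      _ ≤ 4 ^ h * ((splittingSets L h C).card : ℝ) * (4 ^ h * 16) := by
          gcongr
          exact sum_pow_card_inter_le hC hℓ0 hℓ hreg
      _ = _ := by
          rw [show (16 : ℝ) = 4 * 4 by norm_num, pow_succ, mul_pow]; ring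
  exact_mod_cast this

lemma symmDiff_mem_splittingSets {L h : ℕ} {C S : Finset (Fin n)} (hC : C.card = 2 * h)
    (hS : S ∈ splittingSets L h C) : symmDiff S C ∈ splittingSets L h C := by
  obtain ⟨hSL, hSC⟩ := mem_splittingSets.1 hS
  have h1 : symmDiff S C ∩ C = C \ S := by
    ext x; simp only [mem_inter, mem_symmDiff, mem_sdiff]; tauto
  have h2 := card_sdiff_add_card_inter C S
  have h3 := card_sdiff_add_card_inter S C
  have h4 : (symmDiff S C).card = (S \ C).card + (C \ S).card :=
    card_union_of_disjoint disjoint_sdiff_sdiff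
  rw [inter_comm] at h2
  refine mem_splittingSets.2 ⟨by omega, by rw [h1]; omega⟩

/-- The sets splitting `C` evenly that, together with their reflection, split few members of `H`. -/
noncomputable def lightSplittingSets (L h K : ℕ) (H : Finset (Finset (Fin n)))
    (C : Finset (Fin n)) : Finset (Finset (Fin n)) :=
  (splittingSets L h C).filter
    (fun S => splitDegree h H S ≤ K ∧ splitDegree h H (symmDiff S C) ≤ K)

lemma symmDiff_mem_lightSplittingSets {L h K : ℕ} {H : Finset (Finset (Fin n))}
    {C S : Finset (Fin n)} (hC : C.card = 2 * h) (hS : S ∈ lightSplittingSets L h K H C) :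
    symmDiff S C ∈ lightSplittingSets L h K H C := by
  obtain ⟨hS, h1, h2⟩ := mem_filter.1 hS
  exact mem_filter.2 ⟨symmDiff_mem_splittingSets hC hS, h2, by rwa [symmDiff_symmDiff_cancel_right]⟩

lemma card_splittingSets_le_two_mul_light {L h M : ℕ} {H : Finset (Finset (Fin n))}
    {C : Finset (Fin n)} (hC : C.card = 2 * h) (hM : 0 < M)
    (hsum : ∑ S ∈ splittingSets L h C, splitDegree h H S ≤ M * (splittingSets L h C).card) :
    (splittingSets L h C).card ≤ 2 * (lightSplittingSets L h (4 * M) H C).card := by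
  set X := splittingSets L h C
  set T := X.filter (fun S => ¬ splitDegree h H S ≤ 4 * M)
  have hmarkov : 4 * T.card ≤ X.card := by
    refine Nat.le_of_mul_le_mul_left ?_ hM
    calc M * (4 * T.card) = T.card • (4 * M) := by rw [smul_eq_mul]; ring
      _ ≤ ∑ S ∈ T, splitDegree h H S :=
          card_nsmul_le_sum _ _ _ fun S hS => (not_le.1 (mem_filter.1 hS).2).le
      _ ≤ ∑ S ∈ X, splitDegree h H S := sum_le_sum_of_subset (filter_subset _ _)
      _ ≤ _ := hsum
  have hcover : X ⊆ lightSplittingSets L h (4 * M) H C ∪ (T ∪ T.image (fun S => symmDiff S C)) := by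
    intro S hS
    by_cases h1 : splitDegree h H S ≤ 4 * M
    · by_cases h2 : splitDegree h H (symmDiff S C) ≤ 4 * M
      · exact mem_union_left _ (mem_filter.2 ⟨hS, h1, h2⟩)
      · refine mem_union_right _ (mem_union_right _ (mem_image.2 ⟨symmDiff S C, mem_filter.2
          ⟨symmDiff_mem_splittingSets hC hS, h2⟩, symmDiff_symmDiff_cancel_right _ _⟩))
    · exact mem_union_right _ (mem_union_left _ (mem_filter.2 ⟨hS, h1⟩))
  have h1 := (card_le_card hcover).trans (card_union_le _ _)
  have h2 := card_union_le T (T.image (fun S => symmDiff S C))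
  have h3 := card_image_le (s := T) (f := fun S => symmDiff S C)
  omega

end SplittingSets

lemma sum_filter_odd_count {α : Type*} [DecidableEq α] [i : BEq α] [LawfulBEq α] (l : List α)
    (g : α → ZMod 2) :
    ∑ a ∈ l.toFinset.filter (fun a => Odd (l.count a)), g a = (l.map g).sum := by
  obtain rfl : i = instBEqOfDecidableEq := lawful_beq_subsingleton _ _
  rw [Finset.sum_list_map_count, sum_filter]
  refine sum_congr rfl fun a _ => ?_
  rw [nsmul_eq_mul]
  split_ifs with h
  · rw [(ZMod.natCast_eq_one_iff_odd).2 h, one_mul]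
  · rw [(ZMod.natCast_eq_zero_iff_even).2 (Nat.not_odd_iff_even.1 h), zero_mul]

section KikuchiGraph

variable {n p : ℕ}

/-- The indicator of `i ∈ S`, modulo two. -/
noncomputable def parity (i : Fin n) (S : Finset (Fin n)) : ZMod 2 := if i ∈ S then 1 else 0

lemma parity_symmDiff (i : Fin n) (S T : Finset (Fin n)) :
    parity i (symmDiff S T) = parity i S + parity i T := by
  unfold parity
  by_cases hS : i ∈ S <;> by_cases hT : i ∈ T <;>
    simp [mem_symmDiff, hS, hT, CharTwo.add_self_eq_zero]

/-- The label `(u, C, C')` acts on a pair of sets by symmetric difference with `(C, C')`. -/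
noncomputable def kikuchiMove (e : Fin p × Finset (Fin n) × Finset (Fin n))
    (v : Finset (Fin n) × Finset (Fin n)) : Finset (Fin n) × Finset (Fin n) :=
  (symmDiff v.1 e.2.1, symmDiff v.2 e.2.2)

lemma parity_walkEnd_kikuchiMove (i : Fin n) (l : List (Fin p × Finset (Fin n) × Finset (Fin n))) :
    ∀ v, parity i (walkEnd kikuchiMove v l).1 = parity i v.1 + (l.map fun e => parity i e.2.1).sum ∧
      parity i (walkEnd kikuchiMove v l).2 = parity i v.2 + (l.map fun e => parity i e.2.2).sum := by
  induction l with
  | nil => intro v; simp [walkEnd]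
  | cons e l ih =>
    intro v
    obtain ⟨h1, h2⟩ := ih (kikuchiMove e v)
    rw [walkEnd, h1, h2, kikuchiMove, parity_symmDiff, parity_symmDiff]
    simp only [List.map_cons, List.sum_cons]
    exact ⟨by ring, by ring⟩

/-- The hyperedges `(u, C)` and `(u, C')` of each label `(u, C, C')` in a list. -/
def labelHyperedges (l : List (Fin p × Finset (Fin n) × Finset (Fin n))) :
    List (Fin p × Finset (Fin n)) :=
  l.flatMap fun e => [(e.1, e.2.1), (e.1, e.2.2)]

lemma length_labelHyperedges (l : List (Fin p × Finset (Fin n) × Finset (Fin n))) :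
    (labelHyperedges l).length = 2 * l.length := by
  induction l with
  | nil => rfl
  | cons e l ih => simp only [labelHyperedges, List.flatMap_cons, List.length_append] at ih ⊢
                   rw [ih]; simp; ring

lemma sum_map_labelHyperedges (l : List (Fin p × Finset (Fin n) × Finset (Fin n)))
    (g : Fin p × Finset (Fin n) → ZMod 2) :
    ((labelHyperedges l).map g).sum =
      (l.map fun e => g (e.1, e.2.1)).sum + (l.map fun e => g (e.1, e.2.2)).sum := by
  induction l with
  | nil => simp [labelHyperedges]
  | cons e l ih =>
    simp only [labelHyperedges, List.flatMap_cons, List.map_append, List.sum_append] at ih ⊢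
    rw [ih]
    simp
    ring

lemma count_labelHyperedges_eq_zero {l : List (Fin p × Finset (Fin n) × Finset (Fin n))}
    {u : Fin p} (hl : ∀ e ∈ l, e.1 ≠ u) (C : Finset (Fin n)) :
    (labelHyperedges l).count (u, C) = 0 := by
  refine List.count_eq_zero.2 fun h => ?_
  simp only [labelHyperedges, List.mem_flatMap] at h
  obtain ⟨e, he, h⟩ := h
  have := hl e he
  simp at h
  rcases h with h | h <;> exact this h.1.symm

/-- Two walks with common endpoints yield an even cover if some `u` is used by exactly one label of
the first walk and by no label of the second. -/
lemma exists_evenCover_of_walks {B : Fin p → Finset (Finset (Fin n))}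
    {v : Finset (Fin n) × Finset (Fin n)}
    {l l' : List (Fin p × Finset (Fin n) × Finset (Fin n))}
    (hB : ∀ e ∈ l ++ l', e.2.1 ∈ B e.1 ∧ e.2.2 ∈ B e.1 ∧ e.2.1 ≠ e.2.2)
    (hend : walkEnd kikuchiMove v l = walkEnd kikuchiMove v l')
    (hnodup : (l.map Prod.fst).Nodup) (hne : ∃ e ∈ l, ∀ e' ∈ l', e'.1 ≠ e.1) :
    ∃ W, IsBipartiteEvenCover B W ∧ W.card ≤ 2 * (l.length + l'.length) := by
  set L := labelHyperedges (l ++ l') with hL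
  have hLapp : L = labelHyperedges l ++ labelHyperedges l' := by
    simp [hL, labelHyperedges]
  refine ⟨L.toFinset.filter (fun a => Odd (L.count a)), ⟨?_, ?_, ?_, ?_⟩, ?_⟩
  · obtain ⟨e, he, hl'⟩ := hne
    refine ⟨(e.1, e.2.1), ?_⟩
    have hC := (hB e (by simp [he])).2.2
    have hcount : L.count (e.1, e.2.1) = 1 := by
      rw [hLapp, List.count_append, count_labelHyperedges_eq_zero hl']
      obtain ⟨s, t, rfl⟩ := List.append_of_mem he
      have hnd : ∀ a ∈ s ++ t, a.1 ≠ e.1 := by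
        have hperm : ((e :: (s ++ t)).map Prod.fst).Nodup :=
          (List.Perm.nodup_iff (List.perm_middle.map Prod.fst)).1 hnodup
        rw [List.map_cons, List.nodup_cons] at hperm
        exact fun a ha h => hperm.1 (List.mem_map.2 ⟨a, ha, h⟩)
      have hs := count_labelHyperedges_eq_zero (fun a ha => hnd a (List.mem_append_left _ ha)) e.2.1
      have ht := count_labelHyperedges_eq_zero (fun a ha => hnd a (List.mem_append_right _ ha)) e.2.1
      simp only [labelHyperedges] at hs ht
      simp only [labelHyperedges, List.flatMap_append, List.flatMap_cons, List.count_append, hs, ht]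
      simp [hC.symm]
    refine mem_filter.2 ⟨List.mem_toFinset.2 (List.count_pos_iff.1 (by omega)), ?_⟩
    rw [hcount]
    exact odd_one
  · intro a ha
    have ha := List.mem_toFinset.1 (mem_filter.1 ha).1
    simp only [hL, labelHyperedges, List.mem_flatMap] at ha
    obtain ⟨e, he, ha⟩ := ha
    obtain ⟨h1, h2, -⟩ := hB e he
    simp at ha
    rcases ha with rfl | rfl
    · exact h1
    · exact h2
  · intro u
    rw [← ZMod.natCast_eq_zero_iff_even, card_eq_sum_ones, sum_filter, Nat.cast_sum]
    push_cast
    rw [sum_filter_odd_count, hL, sum_map_labelHyperedges]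
    exact CharTwo.add_self_eq_zero _
  · intro i
    rw [← ZMod.natCast_eq_zero_iff_even, card_eq_sum_ones, sum_filter, Nat.cast_sum]
    push_cast
    rw [sum_filter_odd_count, hL, sum_map_labelHyperedges]
    obtain ⟨h1, h2⟩ := parity_walkEnd_kikuchiMove i l v
    obtain ⟨h1', h2'⟩ := parity_walkEnd_kikuchiMove i l' v
    rw [hend, h1'] at h1
    rw [hend, h2'] at h2
    have e1 := add_left_cancel h1
    have e2 := add_left_cancel h2
    unfold parity at e1 e2
    simp only [List.map_append, List.sum_append]
    rw [e1, e2, CharTwo.add_self_eq_zero, CharTwo.add_self_eq_zero, add_zero]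
  · refine (card_filter_le _ _).trans ((List.toFinset_card_le _).trans ?_)
    rw [hL, length_labelHyperedges, List.length_append]

/-- The labels `(u, C, C')` with `C ≠ C'` in `B u`. -/
noncomputable def hyperedgePairs (B : Fin p → Finset (Finset (Fin n))) :
    Finset (Fin p × Finset (Fin n) × Finset (Fin n)) :=
  univ.filter (fun e => e.2.1 ∈ B e.1 ∧ e.2.2 ∈ B e.1 ∧ e.2.1 ≠ e.2.2)

/-- The labels of the edges at a vertex of the pruned bipartite Kikuchi graph. -/
noncomputable def kikuchiOut (B : Fin p → Finset (Finset (Fin n))) (L h K : ℕ)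
    (v : Finset (Fin n) × Finset (Fin n)) : Finset (Fin p × Finset (Fin n) × Finset (Fin n)) :=
  (hyperedgePairs B).filter (fun e => v.1 ∈ lightSplittingSets L h K (B e.1) e.2.1 ∧
    v.2 ∈ lightSplittingSets L h K (B e.1) e.2.2)

lemma mem_hyperedgePairs {B : Fin p → Finset (Finset (Fin n))}
    {e : Fin p × Finset (Fin n) × Finset (Fin n)} :
    e ∈ hyperedgePairs B ↔ e.2.1 ∈ B e.1 ∧ e.2.2 ∈ B e.1 ∧ e.2.1 ≠ e.2.2 := by
  simp [hyperedgePairs]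

lemma card_hyperedgePairs_ge {B : Fin p → Finset (Finset (Fin n))} {M : ℕ}
    (hM : ∀ u, (B u).card = M) : p * (M * (M - 1)) ≤ (hyperedgePairs B).card := by
  have hcard : ((univ : Finset (Fin p)).sigma fun u => (B u).offDiag).card =
      p * (M * (M - 1)) := by
    rw [card_sigma, sum_congr rfl fun u _ => (offDiag_card (B u)).trans (by rw [hM])]
    simp [Nat.mul_sub]
  rw [← hcard]
  refine card_le_card_of_injOn (fun x => (x.1, x.2)) ?_ ?_
  · rintro ⟨u, C, C'⟩ hx
    simpa [mem_hyperedgePairs] using hx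
  · rintro ⟨u, x⟩ _ ⟨u', x'⟩ _ h
    obtain ⟨rfl, rfl⟩ := Prod.mk.inj h
    rfl

lemma card_kikuchiOut_filter_le (B : Fin p → Finset (Finset (Fin n))) (L h K : ℕ)
    (v : Finset (Fin n) × Finset (Fin n)) (u : Fin p) :
    ((kikuchiOut B L h K v).filter (fun e => e.1 = u)).card ≤ K * K := by
  rcases ((kikuchiOut B L h K v).filter (fun e => e.1 = u)).eq_empty_or_nonempty with h0 | ⟨e₀, he₀⟩
  · simp [h0]
  obtain ⟨hmem, rfl⟩ := mem_filter.1 he₀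
  obtain ⟨-, h1, h2⟩ := mem_filter.1 hmem
  have hK1 : splitDegree h (B e₀.1) v.1 ≤ K := (mem_filter.1 h1).2.1
  have hK2 : splitDegree h (B e₀.1) v.2 ≤ K := (mem_filter.1 h2).2.1
  refine le_trans ?_ (Nat.mul_le_mul hK1 hK2)
  rw [splitDegree, splitDegree, ← card_product]
  refine card_le_card_of_injOn Prod.snd ?_ ?_
  · intro e he
    obtain ⟨he, hu⟩ := mem_filter.1 (mem_coe.1 he)
    obtain ⟨hp, h1, h2⟩ := mem_filter.1 he
    obtain ⟨hC, hC', -⟩ := mem_hyperedgePairs.1 hp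
    rw [hu] at hC hC'
    exact mem_coe.2 (mem_product.2
      ⟨mem_filter.2 ⟨hC, (mem_splittingSets.1 (mem_filter.1 h1).1).2⟩,
        mem_filter.2 ⟨hC', (mem_splittingSets.1 (mem_filter.1 h2).1).2⟩⟩)
  · intro e he e' he' hee
    have hu := (mem_filter.1 (mem_coe.1 he)).2
    have hu' := (mem_filter.1 (mem_coe.1 he')).2
    exact Prod.ext (hu.trans hu'.symm) hee

lemma kikuchiMove_mem {B : Fin p → Finset (Finset (Fin n))} {L h K : ℕ}
    {v : Finset (Fin n) × Finset (Fin n)} {e : Fin p × Finset (Fin n) × Finset (Fin n)}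
    (hB : ∀ u, ∀ C ∈ B u, C.card = 2 * h) (he : e ∈ kikuchiOut B L h K v) :
    kikuchiMove e v ∈ powersetCard L univ ×ˢ powersetCard L univ ∧
      e ∈ kikuchiOut B L h K (kikuchiMove e v) ∧ kikuchiMove e (kikuchiMove e v) = v := by
  obtain ⟨hp, h1, h2⟩ := mem_filter.1 he
  obtain ⟨hC, hC', -⟩ := mem_hyperedgePairs.1 hp
  have h1' := symmDiff_mem_lightSplittingSets (hB _ _ hC) h1
  have h2' := symmDiff_mem_lightSplittingSets (hB _ _ hC') h2
  refine ⟨mem_product.2 ⟨?_, ?_⟩, mem_filter.2 ⟨hp, h1', h2'⟩, ?_⟩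
  · exact mem_powersetCard.2 ⟨subset_univ _, (mem_splittingSets.1 (mem_filter.1 h1').1).1⟩
  · exact mem_powersetCard.2 ⟨subset_univ _, (mem_splittingSets.1 (mem_filter.1 h2').1).1⟩
  · simp [kikuchiMove, symmDiff_symmDiff_cancel_right]

lemma sum_card_kikuchiOut_ge {B : Fin p → Finset (Finset (Fin n))} {L h K M Y : ℕ}
    (hM : ∀ u, (B u).card = M)
    (hY : ∀ u, ∀ C ∈ B u, Y ≤ 2 * (lightSplittingSets L h K (B u) C).card) :
    p * (M * (M - 1)) * Y ^ 2 ≤ 4 *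
      ∑ v ∈ powersetCard L univ ×ˢ powersetCard L univ, (kikuchiOut B L h K v).card := by
  have hswap : ∑ v ∈ powersetCard L univ ×ˢ powersetCard L univ, (kikuchiOut B L h K v).card =
      ∑ e ∈ hyperedgePairs B, ((powersetCard L univ ×ˢ powersetCard L univ).filter
        (fun v : Finset (Fin n) × Finset (Fin n) => v.1 ∈ lightSplittingSets L h K (B e.1) e.2.1 ∧
          v.2 ∈ lightSplittingSets L h K (B e.1) e.2.2)).card :=
    sum_card_bipartiteAbove_eq_sum_card_bipartiteBelow
      (fun (v : Finset (Fin n) × Finset (Fin n)) (e : Fin p × Finset (Fin n) × Finset (Fin n)) =>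
        v.1 ∈ lightSplittingSets L h K (B e.1) e.2.1 ∧
          v.2 ∈ lightSplittingSets L h K (B e.1) e.2.2)
  rw [hswap, mul_sum]
  refine (Nat.mul_le_mul_right _ (card_hyperedgePairs_ge hM)).trans ?_
  rw [← smul_eq_mul]
  refine card_nsmul_le_sum _ _ _ fun e he => ?_
  obtain ⟨hC, hC', -⟩ := mem_hyperedgePairs.1 he
  have hsub : lightSplittingSets L h K (B e.1) e.2.1 ×ˢ lightSplittingSets L h K (B e.1) e.2.2 ⊆
      (powersetCard L univ ×ˢ powersetCard L univ).filter
        (fun v : Finset (Fin n) × Finset (Fin n) => v.1 ∈ lightSplittingSets L h K (B e.1) e.2.1 ∧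
          v.2 ∈ lightSplittingSets L h K (B e.1) e.2.2) := by
    intro v hv
    obtain ⟨h1, h2⟩ := mem_product.1 hv
    exact mem_filter.2 ⟨mem_product.2 ⟨(mem_filter.1 (mem_filter.1 h1).1).1,
      (mem_filter.1 (mem_filter.1 h2).1).1⟩, h1, h2⟩
  have hc := card_le_card hsub
  rw [card_product] at hc
  calc Y ^ 2 = Y * Y := sq Y
    _ ≤ (2 * (lightSplittingSets L h K (B e.1) e.2.1).card) *
        (2 * (lightSplittingSets L h K (B e.1) e.2.2).card) :=
      Nat.mul_le_mul (hY _ _ hC) (hY _ _ hC')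
    _ = 4 * ((lightSplittingSets L h K (B e.1) e.2.1).card *
        (lightSplittingSets L h K (B e.1) e.2.2).card) := by ring
    _ ≤ _ := Nat.mul_le_mul_left _ hc

/-- If the pruned bipartite Kikuchi graph is dense enough, the hypergraph has a short even cover. -/
lemma exists_evenCover_of_dense {B : Fin p → Finset (Finset (Fin n))} {L h K M Y t : ℕ}
    (hB : ∀ u, ∀ C ∈ B u, C.card = 2 * h) (hM : ∀ u, (B u).card = M)
    (hY : ∀ u, ∀ C ∈ B u, Y ≤ 2 * (lightSplittingSets L h K (B u) C).card)
    (hLn : L ≤ n) (hK : 0 < K) (ht : 0 < t) (hN : n.choose L ^ 2 < 2 ^ t)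
    (hdense : 24 * (K * K * t) * n.choose L ^ 2 ≤ p * (M * (M - 1)) * Y ^ 2) :
    ∃ W, IsBipartiteEvenCover B W ∧ W.card ≤ 4 * t := by
  set A : Finset (Finset (Fin n) × Finset (Fin n)) :=
    powersetCard L univ ×ˢ powersetCard L univ with hAdef
  have hAcard : A.card = n.choose L ^ 2 := by
    rw [hAdef, card_product, card_powersetCard, card_univ, Fintype.card_fin, sq]
  have hAne : A.Nonempty := by
    rw [← card_pos, hAcard]
    exact pow_pos (Nat.choose_pos hLn) 2
  obtain ⟨A', hA'A, hA'ne, hdeg⟩ := exists_subset_min_degree (out := kikuchiOut B L h K)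
    (τ := kikuchiMove) (d := 3 * (K * K * t)) (fun v e he => (kikuchiMove_mem hB he).2) hAne
    (fun v _ e he => (kikuchiMove_mem hB he).1) (by
      have := hdense.trans (sum_card_kikuchiOut_ge hM hY)
      rw [hAcard]
      linarith)
  obtain ⟨v, hv, l, l', hl, hl', hend, hne⟩ := exists_rainbowWalks_of_min_degree
    (out := fun v => (kikuchiOut B L h K v).filter (fun e => kikuchiMove e v ∈ A'))
    (τ := kikuchiMove) (col := Prod.fst) (A := A') (Δ := K * K) (t := t) hA'ne
    (fun v _ e he => (mem_filter.1 he).2) (by positivity) ht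
    (fun v hv => by convert hdeg v hv)
    (fun v c => by
      refine (card_le_card fun e he => ?_).trans (card_kikuchiOut_filter_le B L h K v c)
      simp only [mem_filter] at he ⊢
      exact ⟨he.1.1, he.2⟩)
    ((card_le_card hA'A).trans_lt (hAcard.trans_lt hN))
  obtain ⟨hlen, hmem, hnodup, -⟩ := rainbowWalks_spec hl
  obtain ⟨hlen', hmem', -⟩ := rainbowWalks_spec hl'
  obtain ⟨W, hW, hWc⟩ := exists_evenCover_of_walks (B := B) (fun e he => by
    have : ∃ w, e ∈ (kikuchiOut B L h K w).filter (fun e => kikuchiMove e w ∈ A') :=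
      (List.mem_append.1 he).elim (hmem e) (hmem' e)
    obtain ⟨w, hw⟩ := this
    exact mem_hyperedgePairs.1 (mem_filter.1 (mem_filter.1 hw).1).1) hend hnodup hne
  exact ⟨W, hW, hWc.trans (by omega)⟩

end KikuchiGraph

/-- The density of the Kikuchi graph guaranteed by the lower bound on the number of hyperedges. -/
lemma kikuchi_density {h n ℓ L p m M t : ℕ} (hh : 1 ≤ h) (hℓh : 4 * h ≤ ℓ) (hℓn : ℓ ≤ n)
    (hp : 0 < p) (hL : L = ℓ / 2) (hpM : p * M = m) (hM : 16 ≤ M)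
    (hm : (1000 : ℝ) ^ (2 * h + 1) * ((n : ℝ) / ℓ) ^ h * √((p : ℝ) * ℓ) * √(Real.logb 2 n) ≤ m)
    (hlog : 1 ≤ Real.logb 2 n) (ht : (t : ℝ) ≤ 2 * (ℓ * Real.logb 2 n)) :
    24 * (4 * 16 ^ (h + 1) * (4 * 16 ^ (h + 1)) * t) * n.choose L ^ 2 ≤
      p * (M * (M - 1)) * (n - 2 * h).choose (L - h) ^ 2 := by
  set g := Real.logb 2 n with hg
  set N := n.choose L
  set Y := (n - 2 * h).choose (L - h)
  have hp' : (0 : ℝ) < p := by exact_mod_cast hp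
  have hℓ' : (0 : ℝ) < ℓ := by exact_mod_cast (show 0 < ℓ by omega)
  have hn' : (0 : ℝ) < n := by exact_mod_cast (show 0 < n by omega)
  have hM' : (16 : ℝ) ≤ M := by exact_mod_cast hM
  have hpM' : (p : ℝ) * M = m := by exact_mod_cast hpM
  have hY : (N : ℝ) * (ℓ : ℝ) ^ h ≤ (24 * (n : ℝ)) ^ h * Y := by
    have h1 : N * L ^ h ≤ (8 * n) ^ h * Y :=
      choose_mul_pow_le (h := h) (by omega) (by omega) h le_rfl
    have h2 : ℓ ≤ 3 * L := by omega
    have h3 : N * ℓ ^ h ≤ (24 * n) ^ h * Y := by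
      calc N * ℓ ^ h ≤ N * (3 * L) ^ h := by gcongr
        _ = 3 ^ h * (N * L ^ h) := by rw [mul_pow]; ring
        _ ≤ 3 ^ h * ((8 * n) ^ h * Y) := by gcongr
        _ = _ := by rw [← mul_assoc, ← mul_pow, ← mul_assoc]; norm_num
    exact_mod_cast h3
  have hY2 : (N : ℝ) ^ 2 ≤ (24 ^ h) ^ 2 * (((n : ℝ) / ℓ) ^ h) ^ 2 * (Y : ℝ) ^ 2 := by
    rw [← mul_pow, ← mul_pow]
    refine pow_le_pow_left₀ (by positivity) ?_ 2
    rw [← mul_pow, ← mul_div_assoc, div_pow, div_mul_eq_mul_div, le_div_iff₀ (by positivity)]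
    exact hY
  have hm2 : ((1000 : ℝ) ^ (2 * h + 1)) ^ 2 * (((n : ℝ) / ℓ) ^ h) ^ 2 * (p * ℓ) * g ≤
      (m : ℝ) ^ 2 := by
    have := pow_le_pow_left₀ (by positivity) hm 2
    rwa [mul_pow, mul_pow, mul_pow, Real.sq_sqrt (by positivity),
      Real.sq_sqrt (by linarith)] at this
  have hMM : (m : ℝ) ^ 2 ≤ 2 * p * (p * ((M : ℝ) * (M - 1))) := by
    rw [← hpM']
    nlinarith [mul_pos hp' hp']
  have hnum : (48 * 2 * 16 * 256 : ℝ) * 256 ^ h * (24 ^ h) ^ 2 ≤ ((1000 : ℝ) ^ (2 * h + 1)) ^ 2 := by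
    have e1 : ((1000 : ℝ) ^ (2 * h + 1)) ^ 2 = 1000 ^ 2 * (1000 ^ 4) ^ h := by
      rw [← pow_mul, ← pow_mul, ← pow_add]; congr 1; ring
    have e2 : (256 : ℝ) ^ h * (24 ^ h) ^ 2 = (256 * 24 ^ 2) ^ h := by
      rw [mul_pow, pow_right_comm]
    rw [e1, mul_assoc, e2]
    gcongr <;> norm_num
  have hfin : (24 * (4 * 16 ^ (h + 1) * (4 * 16 ^ (h + 1)) * t) * N ^ 2 : ℝ) ≤
      p * (M * (M - 1)) * (Y : ℝ) ^ 2 := by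
    have hK : (4 * 16 ^ (h + 1) * (4 * 16 ^ (h + 1)) : ℝ) = 16 * 256 * 256 ^ h := by
      rw [show (256 : ℝ) = 16 * 16 by norm_num, mul_pow]; ring
    rw [hK]
    have hstep : (48 * 16 * 256 * 256 ^ h * (24 ^ h) ^ 2 : ℝ) * (ℓ * g) *
        (((n : ℝ) / ℓ) ^ h) ^ 2 ≤ p * (M * (M - 1)) := by
      have hx : (0 : ℝ) < 2 * p := by positivity
      refine le_of_mul_le_mul_left ?_ hx
      refine le_trans ?_ (hm2.trans hMM)
      have hnn : 0 ≤ (p * (ℓ * g)) * (((n : ℝ) / ℓ) ^ h) ^ 2 := by positivity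
      have := mul_le_mul_of_nonneg_right hnum hnn
      linarith
    calc (24 * (16 * 256 * 256 ^ h * t) * N ^ 2 : ℝ)
        ≤ 24 * (16 * 256 * 256 ^ h * (2 * (ℓ * g))) *
            ((24 ^ h) ^ 2 * (((n : ℝ) / ℓ) ^ h) ^ 2 * (Y : ℝ) ^ 2) := by gcongr
      _ = (48 * 16 * 256 * 256 ^ h * (24 ^ h) ^ 2 : ℝ) * (ℓ * g) *
            (((n : ℝ) / ℓ) ^ h) ^ 2 * (Y : ℝ) ^ 2 := by ring
      _ ≤ _ := by gcongr
  have hcast : ((M - 1 : ℕ) : ℝ) = M - 1 := by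
    rw [Nat.cast_sub (by omega), Nat.cast_one]
  rw [← hcast] at hfin
  exact_mod_cast hfin

lemma choose_sq_lt_two_pow {n ℓ L t : ℕ} (hn : 0 < n) (hL : 2 * L ≤ ℓ)
    (ht : (ℓ : ℝ) * Real.logb 2 n < t) : n.choose L ^ 2 < 2 ^ t := by
  have h1 : n.choose L ^ 2 ≤ n ^ ℓ := by
    calc n.choose L ^ 2 ≤ (n ^ L) ^ 2 := Nat.pow_le_pow_left (Nat.choose_le_pow n L) 2
      _ = n ^ (2 * L) := by rw [← pow_mul, mul_comm]
      _ ≤ n ^ ℓ := Nat.pow_le_pow_right hn hL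
  refine h1.trans_lt ?_
  have hn' : (0 : ℝ) < n := by exact_mod_cast hn
  have : (n : ℝ) ^ ℓ < 2 ^ t := by
    rw [← Real.rpow_natCast 2 t, ← Real.logb_lt_iff_lt_rpow one_lt_two (by positivity),
      Real.logb_pow]
    exact ht
  exact_mod_cast this

/-- There exist absolute constants `c, c₀ > 0` such that: for odd
`k ≥ 3`, `2(k−1) ≤ ℓ ≤ n`, a simple `(1/4,ℓ)`-regular `p`-bipartite `k`-uniform
hypergraph `{B u}_{u∈[p]}` on `[n]` with `m` hyperedges where
`m ≥ max{c^k·(n/ℓ)^{(k−1)/2}·√(pℓ)·(log₂ n)^{2k+0.5}, 16p}` and `|B u| = m/p` for all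
`u`, arbitrary signs `b_{u,C} ∈ {−1,1}`, and
`ψ(y,x) = (1/m) Σ_u y_u Σ_{C∈B u} b_{u,C} x_C`: if the bipartite hypergraph has no even
cover of length at most `c₀·ℓ·log₂ n`, then `val(ψ) ≤ 1/2`. -/
theorem no_even_cover_implies_refutation :
    ∃ c c₀ : ℝ, 0 < c ∧ 0 < c₀ ∧
      ∀ (k n ℓ p m : ℕ)
        (B : Fin p → Finset (Finset (Fin n)))
        (b : Fin p → Finset (Fin n) → ℝ),
        Odd k → 3 ≤ k → 2*(k-1) ≤ ℓ → ℓ ≤ n →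
        (∀ u, ∀ C ∈ B u, C.card = k - 1) →
        -- (1/4, ℓ)-regularity
        (∀ (u : Fin p) (Q : Finset (Fin n)), Q.card ≤ k - 1 →
          (((B u).filter (fun C => Q ⊆ C)).card : ℝ)
            ≤ 16 * max (((n:ℝ)/(ℓ:ℝ)) ^ ((k:ℝ)/2 - 1 - (Q.card:ℝ))) 1) →
        m = ∑ u, (B u).card →
        max (c^k * ((n:ℝ)/(ℓ:ℝ)) ^ (((k:ℝ)-1)/2) * Real.sqrt ((p:ℝ)*(ℓ:ℝ)) *
              (Real.logb 2 n) ^ (2*(k:ℝ) + 0.5))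
            (16*(p:ℝ)) ≤ (m:ℝ) →
        (∀ u, p * (B u).card = m) →
        (∀ u C, b u C = 1 ∨ b u C = -1) →
        (¬ ∃ W : Finset (Fin p × Finset (Fin n)),
            IsBipartiteEvenCover B W ∧ (W.card : ℝ) ≤ c₀ * ℓ * Real.logb 2 n) →
        ∀ (y : Fin p → ℝ) (x : Fin n → ℝ),
          (∀ u, y u = 1 ∨ y u = -1) → (∀ i, x i = 1 ∨ x i = -1) →
          (1/(m:ℝ)) * ∑ u, y u * ∑ C ∈ B u, b u C * ∏ i ∈ C, x i ≤ 1/2 := by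
  refine ⟨1000, 8, by norm_num, by norm_num, ?_⟩
  intro k n ℓ p m B b hk hk3 hkℓ hℓn hcard hreg hm hlarge hequi _ hno y x _ _
  rcases Nat.eq_zero_or_pos p with rfl | hp
  · simp
  refine absurd ?_ hno
  obtain ⟨h, rfl⟩ := hk
  have hh : 1 ≤ h := by omega
  have hℓh : 4 * h ≤ ℓ := by omega
  have hn : 0 < n := by omega
  have hk1 : 2 * h + 1 - 1 = 2 * h := by omega
  rw [hk1] at hcard hreg
  set M := (B ⟨0, hp⟩).card
  have hpM : p * M = m := hequi _
  have hM : ∀ u, (B u).card = M := fun u =>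
    Nat.eq_of_mul_eq_mul_left hp ((hequi u).trans hpM.symm)
  have hp' : (0 : ℝ) < p := by exact_mod_cast hp
  have hM16 : 16 ≤ M := by
    have h1 := (le_max_right _ _).trans hlarge
    rw [← hpM] at h1
    have h2 : 16 * p ≤ p * M := by exact_mod_cast h1
    exact Nat.le_of_mul_le_mul_left (by linarith) hp
  set g := Real.logb 2 n with hg
  have hg1 : 1 ≤ g := by
    rw [hg, Real.le_logb_iff_rpow_le one_lt_two (by exact_mod_cast hn), Real.rpow_one]
    exact_mod_cast (show 2 ≤ n by omega)
  have hℓ1 : (1 : ℝ) ≤ ℓ := by exact_mod_cast (show 1 ≤ ℓ by omega)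
  have hℓg : 1 ≤ ℓ * g := one_le_mul_of_one_le_of_one_le hℓ1 hg1
  set t := ⌊(ℓ : ℝ) * g⌋₊ + 1 with ht
  have ht1 : (ℓ : ℝ) * g < t := by
    rw [ht]; push_cast; exact Nat.lt_floor_add_one _
  have ht2 : (t : ℝ) ≤ 2 * (ℓ * g) := by
    have := Nat.floor_le (show 0 ≤ (ℓ : ℝ) * g by linarith)
    rw [ht]; push_cast; linarith
  have hm' : (1000 : ℝ) ^ (2 * h + 1) * ((n : ℝ) / ℓ) ^ h * √((p : ℝ) * ℓ) * √g ≤ m := by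
    refine le_trans ?_ ((le_max_left _ _).trans hlarge)
    have e : (((2 * h + 1 : ℕ) : ℝ) - 1) / 2 = h := by push_cast; ring
    rw [e, Real.rpow_natCast, Real.sqrt_eq_rpow g]
    gcongr
    push_cast
    linarith [h.cast_nonneg (α := ℝ)]
  have hdense := kikuchi_density hh hℓh hℓn hp rfl hpM hM16 hm' hg1 ht2
  have hlight : ∀ u, ∀ C ∈ B u, (n - 2 * h).choose (ℓ / 2 - h) ≤
      2 * (lightSplittingSets (ℓ / 2) h (4 * 16 ^ (h + 1)) (B u) C).card := by
    intro u C hC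
    refine le_trans ?_ (card_splittingSets_le_two_mul_light (hcard u C hC) (by positivity)
      (sum_splitDegree_le (ℓ := ℓ) (hcard u) (hcard u C hC) (by omega) (by omega) (by omega)
        (by omega) hℓn fun Q hQ => ?_))
    · rw [card_splittingSets (hcard u C hC) (by omega)]
      exact Nat.le_mul_of_pos_left _ (Nat.choose_pos (by omega))
    · convert hreg u Q hQ using 5
      push_cast
      ring
  obtain ⟨W, hW, hWt⟩ := exists_evenCover_of_dense hcard hM hlight (by omega) (by positivity)
    (Nat.succ_pos _) (choose_sq_lt_two_pow hn (by omega) ht1) hdense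
  refine ⟨W, hW, ?_⟩
  have : (W.card : ℝ) ≤ 4 * t := by exact_mod_cast hWt
  linarith
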